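/- For every x ∈ R, the series (1/π)·Σ_{k∈Z} 1/(1+(x+k)²) converges and equals cosh(π)·sinh(π)/(cosh(π)² − cos(πx)²). -/

import Mathlib

open Real

theorem pc_cot_im (x : ℝ) :
    (Complex.cot ((π : ℂ) * ((x : ℂ) + Complex.I))).im =
      - (Real.cosh π * Real.sinh π / (Real.cosh π ^ 2 - Real.cos (π * x) ^ 2)) := by
  have e : (π : ℂ) * ((x : ℂ) + Complex.I) = ((π * x : ℝ) : ℂ) + (π : ℂ) * Complex.I := by
    push_cast; ring
  have hs : Complex.sin ((π : ℂ) * ((x : ℂ) + Complex.I)) =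
      ((Real.sin (π * x) * Real.cosh π : ℝ) : ℂ)
        + ((Real.cos (π * x) * Real.sinh π : ℝ) : ℂ) * Complex.I := by
    rw [e, Complex.sin_add_mul_I]; push_cast; ring
  have hc : Complex.cos ((π : ℂ) * ((x : ℂ) + Complex.I)) =
      ((Real.cos (π * x) * Real.cosh π : ℝ) : ℂ)
        + ((-(Real.sin (π * x) * Real.sinh π) : ℝ) : ℂ) * Complex.I := by
    rw [e, Complex.cos_add_mul_I]; push_cast; ring
  have hn : Complex.normSq (Complex.sin ((π : ℂ) * ((x : ℂ) + Complex.I))) =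
      Real.cosh π ^ 2 - Real.cos (π * x) ^ 2 := by
    rw [hs, Complex.normSq_add_mul_I]
    have h1 := Real.sin_sq_add_cos_sq (π * x)
    have h2 := Real.cosh_sq π
    linear_combination Real.cosh π ^ 2 * h1 - Real.cos (π * x) ^ 2 * h2
  rw [Complex.cot, Complex.div_im, hn, hs, hc]
  simp only [Complex.add_re, Complex.add_im, Complex.mul_re, Complex.mul_im, Complex.I_re, Complex.I_im,
    Complex.ofReal_re, Complex.ofReal_im]
  rw [← sub_div, ← neg_div]
  congr 1
  have h1 := Real.sin_sq_add_cos_sq (π * x)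
  linear_combination - Real.cosh π * Real.sinh π * h1

theorem pc_term (u : ℝ) : (1 / ((u : ℂ) + Complex.I)).im = - (1 / (1 + u ^ 2)) := by
  simp [Complex.normSq_apply, Complex.div_im]
  rw [neg_div, ← one_div]
  ring_nf

/-- For every real `x`, `(1/π)·Σ_{k∈ℤ} 1/(1+(x+k)²)` converges to
`cosh(π)·sinh(π)/(cosh(π)² − cos(πx)²)`. -/
theorem periodized_cauchy (x : ℝ) :
    HasSum (fun k : ℤ => (1 / π) * (1 / (1 + (x + k) ^ 2)))
      (Real.cosh π * Real.sinh π / (Real.cosh π ^ 2 - Real.cos (π * x) ^ 2)) := by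
  set z : ℂ := (x : ℂ) + Complex.I with hz
  have hzi : z ∈ Complex.integerComplement := by
    rintro ⟨n, hn⟩
    have := congrArg Complex.im hn
    simp [hz] at this
  have hS := (summable_cotTerm hzi).hasSum
  have hT : ∑' n, cotTerm z n = π * Complex.cot (π * z) - 1 / z := by
    rw [cot_series_rep' hzi]
  rw [hT] at hS
  have hI := (Complex.hasSum_im hS).neg
  set f : ℤ → ℝ := fun k => 1 / (1 + (x + k) ^ 2) with hf
  have hf0 : ∀ k, 0 ≤ f k := fun k => by simp only [hf]; positivity
  have hterm : (fun n : ℕ => -(cotTerm z n).im) =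
      fun n : ℕ => f ((n : ℤ) + 1) + f (-((n : ℤ) + 1)) := by
    funext n
    have a := pc_term (x + (n + 1))
    have b := pc_term (x - (n + 1))
    have a' : z + ((n : ℂ) + 1) = ((x + (n + 1) : ℝ) : ℂ) + Complex.I := by
      rw [hz]; push_cast; ring
    have b' : z - ((n : ℂ) + 1) = ((x - (n + 1) : ℝ) : ℂ) + Complex.I := by
      rw [hz]; push_cast; ring
    simp only [cotTerm, a', b', Complex.add_im, a, b, hf]
    push_cast
    ring
  rw [hterm] at hI
  have s1 : Summable fun n : ℕ => f ((n : ℤ) + 1) :=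
    hI.summable.of_nonneg_of_le (fun _ => hf0 _) fun n => by linarith [hf0 (-((n : ℤ) + 1))]
  have s2 : Summable fun n : ℕ => f (-((n : ℤ) + 1)) :=
    hI.summable.of_nonneg_of_le (fun _ => hf0 _) fun n => by linarith [hf0 ((n : ℤ) + 1)]
  have hadd := (s1.hasSum.add s2.hasSum).unique hI
  have hall := HasSum.of_add_one_of_neg_add_one s1.hasSum s2.hasSum
  have h := hall.mul_left (1 / π)
  refine (congrArg (HasSum _) ?_).mpr h
  have h0 : f 0 = - (1 / z).im := by rw [hz, pc_term]; simp [hf]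
  have hc := pc_cot_im x
  rw [← hz] at hc
  rw [Complex.sub_im, Complex.im_ofReal_mul, hc] at hadd
  have hpi := Real.pi_ne_zero
  rw [add_right_comm, hadd, h0]
  field_simp
  ring
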